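/- For all ν > 1 and x > 0, P_ν²(x) - P_{ν-1}(x) P_{ν+1}(x) > P_ν²(x) / (1 - ν), where P_ν(x) = I_ν(x) K_ν(x). (Note 1 - ν < 0 here, so the right-hand side is negative.) -/

import Mathlib

open Real MeasureTheory Set Filter

/-- Modified Bessel function of the first kind `I_ν`. -/
noncomputable def besselI (ν x : ℝ) : ℝ :=
  ∑' n : ℕ, (x / 2) ^ (2 * (n : ℝ) + ν) / ((n.factorial : ℝ) * Real.Gamma ((n : ℝ) + ν + 1))

/-- Modified Bessel function of the second kind `K_ν`. -/
noncomputable def besselK (ν x : ℝ) : ℝ :=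
  ∫ t in Ioi (0 : ℝ), Real.exp (-x * Real.cosh t) * Real.cosh (ν * t)

/-- Bessel function of the first kind `J_ν`. -/
noncomputable def besselJ (ν x : ℝ) : ℝ :=
  ∑' n : ℕ, (-1 : ℝ) ^ n * (x / 2) ^ (2 * (n : ℝ) + ν) /
    ((n.factorial : ℝ) * Real.Gamma ((n : ℝ) + ν + 1))

/-- Modified Struve function of the first kind `L_ν`. -/
noncomputable def struveL (ν x : ℝ) : ℝ :=
  ∑' n : ℕ, (x / 2) ^ (2 * (n : ℝ) + ν + 1) /
    (Real.Gamma ((n : ℝ) + 3 / 2) * Real.Gamma ((n : ℝ) + ν + 3 / 2))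

/-- Airy function `Ai`. -/
noncomputable def airyAi (t : ℝ) : ℝ :=
  (1 / Real.pi) * ∫ s in Ioi (0 : ℝ), Real.cos (s ^ 3 / 3 + s * t)

/-- Landau constant `b_L = 2^{1/3} ⬝ sup_{t ≥ 0} Ai(t)`. -/
noncomputable def landau_bL : ℝ :=
  (2 : ℝ) ^ ((1 : ℝ) / 3) * sSup (airyAi '' Ici 0)

/-- Landau constant `c_L = sup_{t ≥ 0} t^{1/3} J₀(t)`. -/
noncomputable def landau_cL : ℝ :=
  sSup ((fun t : ℝ => t ^ ((1 : ℝ) / 3) * besselJ 0 t) '' Ici 0)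

/-- The `n`-th term of the series defining `besselI ν x`. -/
noncomputable def besselITerm (ν x : ℝ) (n : ℕ) : ℝ :=
  (x / 2) ^ (2 * (n : ℝ) + ν) / ((n.factorial : ℝ) * Real.Gamma ((n : ℝ) + ν + 1))

theorem besselITerm_pos {ν x : ℝ} (hν : 0 < ν) (hx : 0 < x) (n : ℕ) :
    0 < besselITerm ν x n := by
  have := Real.Gamma_pos_of_pos (show (0 : ℝ) < (n : ℝ) + ν + 1 by positivity)
  unfold besselITerm
  positivity

theorem Gamma_add_one_le_Gamma_nat_add {ν : ℝ} (hν : 0 < ν) (n : ℕ) :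
    Real.Gamma (ν + 1) ≤ Real.Gamma ((n : ℝ) + ν + 1) := by
  induction n with
  | zero => simp
  | succ n ih =>
    have hpos := Real.Gamma_pos_of_pos (show (0 : ℝ) < (n : ℝ) + ν + 1 by positivity)
    have h := Real.Gamma_add_one (show (n : ℝ) + ν + 1 ≠ 0 by positivity)
    have hcast : ((n + 1 : ℕ) : ℝ) + ν + 1 = (n : ℝ) + ν + 1 + 1 := by push_cast; ring
    rw [hcast, h]
    have hn : (0 : ℝ) ≤ n := n.cast_nonneg
    nlinarith

theorem summable_besselITerm {ν x : ℝ} (hν : 0 < ν) (hx : 0 < x) :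
    Summable (besselITerm ν x) := by
  have hG := Real.Gamma_pos_of_pos (show (0 : ℝ) < ν + 1 by positivity)
  refine Summable.of_nonneg_of_le (fun n => (besselITerm_pos hν hx n).le) (fun n => ?_)
    ((Real.summable_pow_div_factorial ((x / 2) ^ 2)).mul_left ((x / 2) ^ ν / Real.Gamma (ν + 1)))
  have hpow : (x / 2) ^ (2 * (n : ℝ) + ν) = (x / 2) ^ ν * ((x / 2) ^ 2) ^ n := by
    rw [Real.rpow_add (by positivity), ← pow_mul, ← Real.rpow_natCast]
    push_cast
    ring
  calc besselITerm ν x n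
      ≤ (x / 2) ^ (2 * (n : ℝ) + ν) / ((n.factorial : ℝ) * Real.Gamma (ν + 1)) := by
        unfold besselITerm
        gcongr
        exact Gamma_add_one_le_Gamma_nat_add hν n
    _ = _ := by rw [hpow]; field_simp

theorem hasSum_besselITerm {ν x : ℝ} (hν : 0 < ν) (hx : 0 < x) :
    HasSum (besselITerm ν x) (besselI ν x) :=
  (summable_besselITerm hν hx).hasSum

theorem besselI_pos {ν x : ℝ} (hν : 0 < ν) (hx : 0 < x) : 0 < besselI ν x :=
  (summable_besselITerm hν hx).tsum_pos (fun n => (besselITerm_pos hν hx n).le) 0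
    (besselITerm_pos hν hx 0)

theorem besselITerm_sub_one {ν x : ℝ} (hν : 0 < ν) (hx : 0 < x) (n : ℕ) :
    ((n : ℝ) + ν) * besselITerm ν x n = x / 2 * besselITerm (ν - 1) x n := by
  have hG := Real.Gamma_pos_of_pos (show (0 : ℝ) < (n : ℝ) + ν by positivity)
  have h := Real.Gamma_add_one (show (n : ℝ) + ν ≠ 0 by positivity)
  have hpow : (x / 2) ^ (2 * (n : ℝ) + ν) = x / 2 * (x / 2) ^ (2 * (n : ℝ) + (ν - 1)) := by
    rw [show 2 * (n : ℝ) + ν = 1 + (2 * (n : ℝ) + (ν - 1)) by ring,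
      Real.rpow_add (by positivity), Real.rpow_one]
  unfold besselITerm
  rw [h, hpow, show (n : ℝ) + (ν - 1) + 1 = n + ν by ring]
  field_simp

theorem succ_mul_besselITerm_succ {ν x : ℝ} (hν : 0 < ν) (hx : 0 < x) (n : ℕ) :
    ((n + 1 : ℕ) : ℝ) * besselITerm ν x (n + 1) = x / 2 * besselITerm (ν + 1) x n := by
  have hG := Real.Gamma_pos_of_pos (show (0 : ℝ) < (n : ℝ) + (ν + 1) + 1 by positivity)
  have hpow : (x / 2) ^ (2 * ((n + 1 : ℕ) : ℝ) + ν) =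
      x / 2 * (x / 2) ^ (2 * (n : ℝ) + (ν + 1)) := by
    rw [show 2 * ((n + 1 : ℕ) : ℝ) + ν = 1 + (2 * (n : ℝ) + (ν + 1)) by push_cast; ring,
      Real.rpow_add (by positivity), Real.rpow_one]
  unfold besselITerm
  rw [hpow, Nat.factorial_succ,
    show ((n + 1 : ℕ) : ℝ) + ν + 1 = (n : ℝ) + (ν + 1) + 1 by push_cast; ring]
  push_cast
  field_simp

theorem hasSum_nat_mul_besselITerm {ν x : ℝ} (hν : 0 < ν) (hx : 0 < x) :
    HasSum (fun n : ℕ => (n : ℝ) * besselITerm ν x n) (x / 2 * besselI (ν + 1) x) := by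
  rw [← hasSum_nat_add_iff' 1]
  simp only [succ_mul_besselITerm_succ hν hx]
  simpa using (hasSum_besselITerm (add_pos hν one_pos) hx).mul_left (x / 2)

theorem hasSum_nat_mul_add_mul_besselITerm {ν x : ℝ} (hν : 0 < ν) (hx : 0 < x) :
    HasSum (fun n : ℕ => (n : ℝ) * (n + ν) * besselITerm ν x n)
      ((x / 2) ^ 2 * besselI ν x) := by
  rw [← hasSum_nat_add_iff' 1]
  have h (n : ℕ) : ((n + 1 : ℕ) : ℝ) * ((n + 1 : ℕ) + ν) * besselITerm ν x (n + 1) =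
      (x / 2) ^ 2 * besselITerm ν x n := by
    have h1 := succ_mul_besselITerm_succ hν hx n
    have h2 := besselITerm_sub_one (add_pos hν one_pos) hx n
    rw [add_sub_cancel_right] at h2
    push_cast at h1 ⊢
    linear_combination ((n : ℝ) + 1 + ν) * h1 + x / 2 * h2
  simp only [h]
  simpa using (hasSum_besselITerm hν hx).mul_left ((x / 2) ^ 2)

/-- Turán inequality for `I_ν`. -/
theorem besselI_sub_one_mul_besselI_add_one_le {ν x : ℝ} (hν : 1 < ν) (hx : 0 < x) :
    besselI (ν - 1) x * besselI (ν + 1) x ≤ besselI ν x ^ 2 := by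
  have hν0 : 0 < ν := by linarith
  have h0 := hasSum_besselITerm hν0 hx
  have h1 := hasSum_nat_mul_besselITerm hν0 hx
  have h2 := hasSum_nat_mul_add_mul_besselITerm hν0 hx
  have hrec : x / 2 * besselI (ν + 1) x + ν * besselI ν x = x / 2 * besselI (ν - 1) x := by
    refine (h1.add (h0.mul_left ν)).unique ?_
    refine ((hasSum_besselITerm (sub_pos.2 hν) hx).mul_left (x / 2)).congr_fun fun n => ?_
    rw [← besselITerm_sub_one hν0 hx]
    ring
  -- Cauchy–Schwarz for the weights `besselITerm ν x n` and the functions `1`, `n`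
  have hquad (s : ℝ) : 0 ≤ besselI ν x * (s * s) + (-2 * (x / 2 * besselI (ν + 1) x)) * s +
      ((x / 2) ^ 2 * besselI ν x - ν * (x / 2 * besselI (ν + 1) x)) := by
    refine HasSum.nonneg (fun n => ?_)
      (((h0.mul_right (s * s)).add ((h1.mul_left (-2)).mul_right s)).add
        (h2.sub (h1.mul_left ν)))
    have := mul_nonneg (besselITerm_pos hν0 hx n).le (sq_nonneg (s - n))
    linarith
  have hdisc := discrim_le_zero hquad
  unfold discrim at hdisc
  have key : (x / 2) ^ 2 * (besselI (ν - 1) x * besselI (ν + 1) x) ≤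
      (x / 2) ^ 2 * besselI ν x ^ 2 := by
    have : (x / 2) ^ 2 * (besselI (ν - 1) x * besselI (ν + 1) x) =
      (x / 2 * besselI (ν + 1) x + ν * besselI ν x) * (x / 2 * besselI (ν + 1) x) := by
      rw [hrec]; ring
    linarith
  exact le_of_mul_le_mul_left key (by positivity)

theorem cosh_le_exp_abs_mul (ν : ℝ) {t : ℝ} (ht : 0 ≤ t) :
    Real.cosh (ν * t) ≤ Real.exp (|ν| * t) := by
  rw [← Real.cosh_abs, abs_mul, abs_of_nonneg ht, Real.cosh_eq]
  have : Real.exp (-(|ν| * t)) ≤ Real.exp (|ν| * t) :=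
    Real.exp_le_exp.2 (by have := mul_nonneg (abs_nonneg ν) ht; linarith)
  linarith

theorem eventually_exp_neg_mul_cosh_mul_cosh_le (ν : ℝ) {x : ℝ} (hx : 0 < x) :
    ∀ᶠ t in atTop, Real.exp (-x * Real.cosh t) * Real.cosh (ν * t) ≤ Real.exp (-t) := by
  filter_upwards [eventually_ge_atTop (4 * (|ν| + 1) / x), eventually_ge_atTop 0] with t ht ht0
  have hcosh : t ^ 2 / 4 ≤ Real.cosh t := by
    rw [Real.cosh_eq]
    have h1 := Real.quadratic_le_exp_of_nonneg ht0
    have h2 := Real.exp_pos (-t)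
    linarith
  rw [div_le_iff₀ hx] at ht
  calc Real.exp (-x * Real.cosh t) * Real.cosh (ν * t)
      ≤ Real.exp (-x * Real.cosh t) * Real.exp (|ν| * t) := by
        gcongr
        exact cosh_le_exp_abs_mul ν ht0
    _ = Real.exp (-x * Real.cosh t + |ν| * t) := (Real.exp_add _ _).symm
    _ ≤ Real.exp (-t) := Real.exp_le_exp.2 (by nlinarith)

theorem integrableOn_besselK (ν : ℝ) {x : ℝ} (hx : 0 < x) :
    IntegrableOn (fun t => Real.exp (-x * Real.cosh t) * Real.cosh (ν * t)) (Ioi 0) := by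
  refine integrable_of_isBigO_exp_neg one_pos (by fun_prop) (Asymptotics.IsBigO.of_bound 1 ?_)
  filter_upwards [eventually_exp_neg_mul_cosh_mul_cosh_le ν hx] with t ht
  rw [Real.norm_of_nonneg (by positivity), Real.norm_of_nonneg (by positivity)]
  simpa using ht

theorem besselK_pos (ν : ℝ) {x : ℝ} (hx : 0 < x) : 0 < besselK ν x := by
  refine (setIntegral_pos_iff_support_of_nonneg_ae
    (Eventually.of_forall fun t => by dsimp; positivity) (integrableOn_besselK ν hx)).2 ?_
  have : Function.support (fun t => Real.exp (-x * Real.cosh t) * Real.cosh (ν * t)) = univ :=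
    Function.support_eq_univ fun t => by positivity
  rw [this, univ_inter, Real.volume_Ioi]
  exact ENNReal.zero_lt_top

theorem besselK_sub_one_mul_besselK_add_one_ge (ν : ℝ) {x : ℝ} (hx : 0 < x) :
    besselK ν x ^ 2 ≤ besselK (ν - 1) x * besselK (ν + 1) x := by
  have hA := integrableOn_besselK (ν - 1) hx
  have hB := integrableOn_besselK ν hx
  have hC := integrableOn_besselK (ν + 1) hx
  have hquad (s : ℝ) : 0 ≤ besselK (ν - 1) x * (s * s) + (2 * besselK ν x) * s +
      besselK (ν + 1) x := by
    unfold besselK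
    rw [← integral_const_mul, ← integral_mul_const, ← integral_mul_const, ← integral_add,
      ← integral_add]
    · refine integral_nonneg fun t => ?_
      have h1 : Real.cosh ((ν - 1) * t) =
          Real.cosh (ν * t) * Real.cosh t - Real.sinh (ν * t) * Real.sinh t := by
        rw [sub_mul, one_mul, Real.cosh_sub]
      have h2 : Real.cosh ((ν + 1) * t) =
          Real.cosh (ν * t) * Real.cosh t + Real.sinh (ν * t) * Real.sinh t := by
        rw [add_mul, one_mul, Real.cosh_add]
      have hpos := Real.cosh_pos ((ν - 1) * t)
      have hdet : 0 ≤ Real.cosh ((ν - 1) * t) * Real.cosh ((ν + 1) * t) -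
          Real.cosh (ν * t) ^ 2 := by
        have : Real.cosh ((ν - 1) * t) * Real.cosh ((ν + 1) * t) -
            Real.cosh (ν * t) ^ 2 = Real.sinh t ^ 2 := by
          rw [h1, h2]
          linear_combination Real.cosh (ν * t) ^ 2 * Real.cosh_sq t -
            Real.sinh t ^ 2 * Real.sinh_sq (ν * t)
        rw [this]
        positivity
      have hpt : 0 ≤ Real.cosh ((ν - 1) * t) * (s * s) + 2 * Real.cosh (ν * t) * s +
          Real.cosh ((ν + 1) * t) := by
        refine nonneg_of_mul_nonneg_right ?_ hpos
        linarith [sq_nonneg (Real.cosh ((ν - 1) * t) * s + Real.cosh (ν * t))]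
      have := mul_nonneg (Real.exp_pos (-x * Real.cosh t)).le hpt
      dsimp
      linarith
    · exact (hA.mul_const _).add ((hB.const_mul _).mul_const _)
    · exact hC
    · exact hA.mul_const _
    · exact (hB.const_mul _).mul_const _
  have hdisc := discrim_le_zero hquad
  unfold discrim at hdisc
  linarith

theorem besselK_add_one (ν : ℝ) {x : ℝ} (hx : 0 < x) :
    x * besselK (ν + 1) x = x * besselK (ν - 1) x + 2 * ν * besselK ν x := by
  let F (μ t : ℝ) : ℝ := Real.exp (-x * Real.cosh t) * Real.cosh (μ * t)
  have hF (c μ : ℝ) : IntegrableOn (fun t => c * F μ t) (Ioi 0) :=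
    (integrableOn_besselK μ hx).const_mul c
  have hderiv (t : ℝ) : HasDerivAt (fun t => Real.exp (-x * Real.cosh t) * Real.sinh (ν * t))
      (x / 2 * F (ν - 1) t + ν * F ν t - x / 2 * F (ν + 1) t) t := by
    have h := (((Real.hasDerivAt_cosh t).const_mul (-x)).exp).mul
      ((hasDerivAt_id t).const_mul ν).sinh
    refine h.congr_deriv ?_
    simp only [F, id_eq, sub_mul, add_mul, one_mul, Real.cosh_sub, Real.cosh_add]
    ring
  have hlim : Tendsto (fun t => Real.exp (-x * Real.cosh t) * Real.sinh (ν * t)) atTop (nhds 0) := by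
    refine squeeze_zero_norm' ?_ (Real.tendsto_exp_neg_atTop_nhds_zero)
    filter_upwards [eventually_exp_neg_mul_cosh_mul_cosh_le ν hx] with t ht
    refine le_trans ?_ ht
    rw [norm_mul, Real.norm_of_nonneg (Real.exp_pos _).le]
    gcongr
    rw [Real.norm_eq_abs]
    exact abs_le_of_sq_le_sq (by linarith [Real.cosh_sq (ν * t)]) (Real.cosh_pos (ν * t)).le
  have hint := integral_Ioi_of_hasDerivAt_of_tendsto' (a := (0 : ℝ)) (fun t _ => hderiv t)
    (((hF _ _).add (hF _ _)).sub (hF _ _)) hlim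
  rw [integral_sub (by exact (hF _ _).add (hF _ _)) (hF _ _),
    integral_add (hF _ _) (hF _ _), integral_const_mul, integral_const_mul,
    integral_const_mul] at hint
  change x / 2 * besselK (ν - 1) x + ν * besselK ν x - x / 2 * besselK (ν + 1) x = _ at hint
  simp only [mul_zero, Real.sinh_zero, sub_zero] at hint
  linarith

/-- Turán inequality for `K_ν`. -/
theorem besselK_sub_one_mul_besselK_add_one_lt {ν x : ℝ} (hν : 1 < ν) (hx : 0 < x) :
    (ν - 1) * (besselK (ν - 1) x * besselK (ν + 1) x) < ν * besselK ν x ^ 2 := by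
  have ha := besselK_pos (ν - 1) hx
  have hb := besselK_pos ν hx
  have hcs := besselK_sub_one_mul_besselK_add_one_ge (ν - 1) hx
  have h1 := besselK_add_one (ν - 1) hx
  have h2 := besselK_add_one ν hx
  rw [sub_add_cancel] at hcs h1
  generalize besselK (ν - 1 - 1) x = d at *
  generalize besselK (ν - 1) x = a at *
  generalize besselK (ν + 1) x = c at *
  generalize besselK ν x = b at *
  have hcs' : x * a ^ 2 + 2 * (ν - 1) * (a * b) ≤ x * b ^ 2 := by
    have := mul_le_mul_of_nonneg_left hcs hx.le
    linear_combination this - b * h1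
  have hapos : 0 < x * a ^ 2 := by positivity
  have hac : x * (a * c) = x * a ^ 2 + 2 * ν * (a * b) := by linear_combination a * h2
  have hac' : x * (a * c) ≤ x * b ^ 2 + 2 * (a * b) := by linarith
  have := mul_le_mul_of_nonneg_left hac' (sub_pos.2 hν).le
  refine lt_of_mul_lt_mul_left ?_ hx.le
  linarith

theorem stmt17 (ν x : ℝ) (hν : 1 < ν) (hx : 0 < x) :
    (besselI ν x * besselK ν x) ^ 2 -
        (besselI (ν - 1) x * besselK (ν - 1) x) * (besselI (ν + 1) x * besselK (ν + 1) x) >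
      (besselI ν x * besselK ν x) ^ 2 / (1 - ν) := by
  have hI := besselI_sub_one_mul_besselI_add_one_le hν hx
  have hK := besselK_sub_one_mul_besselK_add_one_lt hν hx
  have hI0 := besselI_pos (zero_lt_one.trans hν) hx
  have hK1 := mul_pos (besselK_pos (ν - 1) hx) (besselK_pos (ν + 1) hx)
  have hν1 : 0 < ν - 1 := sub_pos.2 hν
  have hprod : (ν - 1) * (besselI (ν - 1) x * besselI (ν + 1) x *
      (besselK (ν - 1) x * besselK (ν + 1) x)) < ν * (besselI ν x * besselK ν x) ^ 2 := by
    have h1 := mul_le_mul_of_nonneg_right hI (mul_pos hν1 hK1).le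
    have h2 := mul_lt_mul_of_pos_left hK (pow_pos hI0 2)
    linarith
  rw [gt_iff_lt, div_lt_iff_of_neg (by linarith)]
  linarith
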